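/- In a CC-loop, if c is a WIP element and b and c are power-associative elements, then the subloop ⟨b², c⟩ generated by {b·b, c} is a group: x·(y·z) = (x·y)·z for all x, y, z in ⟨b·b, c⟩. -/

import Mathlib

/-- A loop: a type with multiplication, identity, and two-sided division. -/
class Loop (Q : Type*) extends Mul Q, One Q where
  ld : Q → Q → Q  -- left division: `ld x y = x \ y`
  rd : Q → Q → Q  -- right division: `rd x y = x / y`
  one_mul : ∀ x : Q, 1 * x = x
  mul_one : ∀ x : Q, x * 1 = x
  mul_ld : ∀ x y : Q, x * ld x y = y
  ld_mul : ∀ x y : Q, ld x (x * y) = y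
  rd_mul : ∀ x y : Q, rd x y * y = x
  mul_rd : ∀ x y : Q, rd (x * y) y = x

namespace Loop

variable {Q : Type*} [Loop Q]

/-- A conjugacy closed loop (CC-loop). -/
def IsCC (Q : Type*) [Loop Q] : Prop :=
  (∀ x y z : Q, x * (y * z) = rd (x * y) x * (x * z)) ∧
  (∀ x y z : Q, (z * y) * x = (z * x) * ld x (y * x))

/-- The nucleus `N(Q)`. -/
def nucleus (Q : Type*) [Loop Q] : Set Q :=
  {a | (∀ x y : Q, a * (x * y) = (a * x) * y) ∧
       (∀ x y : Q, x * (a * y) = (x * a) * y) ∧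
       (∀ x y : Q, x * (y * a) = (x * y) * a)}

/-- A subloop: contains 1 and is closed under `·`, `\`, `/`. -/
def IsSubloop (S : Set Q) : Prop :=
  (1 : Q) ∈ S ∧ (∀ a ∈ S, ∀ b ∈ S, a * b ∈ S) ∧
  (∀ a ∈ S, ∀ b ∈ S, ld a b ∈ S) ∧ (∀ a ∈ S, ∀ b ∈ S, rd a b ∈ S)

/-- The subloop generated by a set `S`. -/
def closure (S : Set Q) : Set Q := ⋂₀ {T : Set Q | IsSubloop T ∧ S ⊆ T}

/-- An element is power-associative if the subloop it generates is associative. -/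
def IsPA (a : Q) : Prop :=
  ∀ x ∈ closure {a}, ∀ y ∈ closure {a}, ∀ z ∈ closure {a}, x * (y * z) = (x * y) * z

/-- Powers: `pow a 0 = 1`, `pow a (n+1) = a * pow a n`. -/
def pow (a : Q) : ℕ → Q
  | 0 => 1
  | n + 1 => a * pow a n

/-- A WIP (weak inverse property) element. -/
def IsWIP (c : Q) : Prop := ∀ x : Q, c * ld (x * c) 1 = ld x 1

end Loop

namespace Loop

section aux
variable {Q : Type*} [Loop Q]

theorem lcancel {a x y : Q} (h : a * x = a * y) : x = y := by
  rw [← ld_mul a x, h, ld_mul]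

theorem rcancel {a x y : Q} (h : x * a = y * a) : x = y := by
  rw [← mul_rd x a, h, mul_rd]

def Lp (x : Q) : Equiv.Perm Q := ⟨fun y => x * y, fun y => ld x y, ld_mul x, mul_ld x⟩
def Rp (x : Q) : Equiv.Perm Q :=
  ⟨fun y => y * x, fun y => rd y x, fun y => mul_rd y x, fun y => rd_mul y x⟩

def Atp (A B C : Equiv.Perm Q) : Prop := ∀ x y, A x * B y = C (x * y)

theorem Atp.comp {A B C A' B' C' : Equiv.Perm Q} (h : Atp A B C) (h' : Atp A' B' C') :
    Atp (A * A') (B * B') (C * C') := by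
  intro x y
  simp only [Equiv.Perm.mul_apply]
  rw [h, h']

theorem Atp.inv {A B C : Equiv.Perm Q} (h : Atp A B C) : Atp A⁻¹ B⁻¹ C⁻¹ := by
  intro x y
  apply C.injective
  rw [← h]
  simp

theorem atp_a (h : IsCC Q) (x : Q) : Atp ((Rp x)⁻¹ * Lp x) (Lp x) (Lp x) :=
  fun y z => (h.1 x y z).symm

theorem atp_b (h : IsCC Q) (x : Q) : Atp (Rp x) ((Lp x)⁻¹ * Rp x) (Rp x) :=
  fun z y => (h.2 x y z).symm

theorem nuc_of_mid (h : IsCC Q) {m : Q} (hm : ∀ x y, x * (m * y) = (x * m) * y) :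
    m ∈ nucleus Q := by
  refine ⟨fun x y => ?_, hm, fun x y => ?_⟩
  · rw [h.1 m x y, hm, rd_mul]
  · rw [h.2 m y x, ← hm, mul_ld]

theorem mid_of_atp {A B : Equiv.Perm Q} (h : Atp A B 1) (p q : Q) :
    p * (A 1 * q) = (p * A 1) * q := by
  have h0 : ∀ p q, A p * B q = p * q := h
  have h1 : ∀ q, A 1 * B q = q := fun q => by rw [h0, one_mul]
  have h2 : ∀ q, B (A 1 * q) = q := fun q => lcancel (h1 (A 1 * q))
  have h3 : ∀ p q, A p * q = p * (A 1 * q) := fun p q => by rw [← h0 p, h2]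
  have h4 : ∀ p, A p = p * A 1 := fun p => by
    have := h3 p 1
    rwa [mul_one, mul_one] at this
  rw [← h3, h4]

theorem Rp_mul (h : IsCC Q) (x z : Q) : Rp (x * z) = Lp x * Rp z * (Lp x)⁻¹ * Rp x := by
  have : Rp (x * z) * ((Rp x)⁻¹ * Lp x) = Lp x * Rp z := by
    ext y
    exact (h.1 x y z).symm
  calc _ = Rp (x * z) * ((Rp x)⁻¹ * Lp x) * ((Lp x)⁻¹ * Rp x) := by group
    _ = _ := by rw [this]; group

theorem comm_mem (h : IsCC Q) (x w : Q) : rd (ld x (w * x)) w ∈ nucleus Q := by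
  obtain ⟨z, rfl⟩ : ∃ z, w = x * z := ⟨ld x w, (mul_ld _ _).symm⟩
  have key := ((((atp_a h x).comp (atp_b h z).inv).comp (atp_a h x).inv).comp
    (atp_b h (x * z))).comp (atp_b h x).inv
  have hC : Lp x * (Rp z)⁻¹ * (Lp x)⁻¹ * Rp (x * z) * (Rp x)⁻¹ = 1 := by
    rw [Rp_mul h]; group
  rw [hC] at key
  have hA : (Rp x)⁻¹ * Lp x * (Rp z)⁻¹ * ((Rp x)⁻¹ * Lp x)⁻¹ * Rp (x * z) * (Rp x)⁻¹
      = (Rp (x * z))⁻¹ * (Rp x * (Rp (x * z) * (Rp x)⁻¹)) := by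
    rw [Rp_mul h]; group
  rw [hA] at key
  have hm := nuc_of_mid h (mid_of_atp key)
  have e : ((Rp (x * z))⁻¹ * (Rp x * (Rp (x * z) * (Rp x)⁻¹))) 1
      = rd (((rd 1 x) * (x * z)) * x) (x * z) := rfl
  rw [e, h.2, rd_mul, one_mul] at hm
  exact hm

theorem comm1 (h : IsCC Q) (x w : Q) : ∃ m ∈ nucleus Q, w * x = x * (m * w) :=
  ⟨_, comm_mem h x w, by rw [rd_mul, mul_ld]⟩

theorem nuc_mul {a b : Q} (ha : a ∈ nucleus Q) (hb : b ∈ nucleus Q) : a * b ∈ nucleus Q := by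
  obtain ⟨a1, a2, a3⟩ := ha
  obtain ⟨b1, b2, b3⟩ := hb
  refine ⟨fun x y => ?_, fun x y => ?_, fun x y => ?_⟩
  · rw [← a1, b1, a1, a1]
  · rw [← a1, a2, b2, a2]
  · rw [a2, b3, b3, a3, ← b3]

theorem nuc_one : (1 : Q) ∈ nucleus Q := by
  refine ⟨fun x y => ?_, fun x y => ?_, fun x y => ?_⟩ <;> simp only [one_mul, mul_one]

theorem nuc_inv_mul {a : Q} (ha : a ∈ nucleus Q) : ld a 1 * a = 1 := by
  apply lcancel (a := a)
  rw [ha.1, mul_ld, one_mul, mul_one]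

theorem nuc_inv {a : Q} (ha : a ∈ nucleus Q) : ld a 1 ∈ nucleus Q := by
  have e := nuc_inv_mul ha
  obtain ⟨a1, a2, a3⟩ := ha
  refine ⟨fun x y => ?_, fun x y => ?_, fun x y => ?_⟩
  · apply lcancel (a := a)
    rw [a1, a1, a1, mul_ld, one_mul, one_mul]
  · obtain ⟨z, rfl⟩ : ∃ z, y = a * z := ⟨ld a y, (mul_ld _ _).symm⟩
    rw [a2 (ld a 1), e, one_mul, a2, ← a3, e, mul_one]
  · apply rcancel (a := a)
    rw [← a3, ← a3, ← a3, e, mul_one, mul_one]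

/-- move right -/
theorem mv_r (h : IsCC Q) {n : Q} (hn : n ∈ nucleus Q) (y : Q) :
    ∃ m ∈ nucleus Q, n * y = y * m := by
  obtain ⟨k, hk, e⟩ := comm1 h y n
  exact ⟨_, nuc_mul hk hn, e⟩

theorem mv_l (h : IsCC Q) {n : Q} (hn : n ∈ nucleus Q) (y : Q) :
    ∃ m ∈ nucleus Q, y * n = m * y := by
  obtain ⟨k, hk, e⟩ := comm1 h n y
  exact ⟨_, nuc_mul hn hk, by rw [e, hn.1]⟩

theorem comm2 (h : IsCC Q) (y z : Q) : ∃ m ∈ nucleus Q, y * z = (z * y) * m := by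
  obtain ⟨k, hk, e⟩ := comm1 h z y
  obtain ⟨m, hm, e'⟩ := mv_r h hk y
  exact ⟨m, hm, by rw [e, e', hm.2.2]⟩

theorem comm3 (h : IsCC Q) (y z : Q) : ∃ m ∈ nucleus Q, y * z = m * (z * y) := by
  obtain ⟨k, hk, e⟩ := comm2 h y z
  obtain ⟨m, hm, e'⟩ := mv_l h hk (z * y)
  exact ⟨m, hm, by rw [e, e']⟩

def Eqv (a b : Q) : Prop := ∃ n ∈ nucleus Q, a = b * n

theorem Eqv.trans {a b c : Q} (h : Eqv a b) (h' : Eqv b c) : Eqv a c := by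
  obtain ⟨n, hn, rfl⟩ := h
  obtain ⟨m, hm, rfl⟩ := h'
  exact ⟨m * n, nuc_mul hm hn, by rw [hn.2.2]⟩

theorem Eqv.mul_left {a b : Q} (c : Q) (h : Eqv a b) : Eqv (c * a) (c * b) := by
  obtain ⟨n, hn, rfl⟩ := h
  exact ⟨n, hn, hn.2.2 _ _⟩

theorem swapL (h : IsCC Q) (x y z : Q) : ∃ n ∈ nucleus Q,
    x * y = n * (y * x) ∧ x * (y * z) = n * (y * (x * z)) := by
  obtain ⟨n, hn, e⟩ := comm3 h x y
  refine ⟨n, hn, e, ?_⟩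
  rw [h.1, e, hn.1 y x, mul_rd, hn.1]

theorem swapR (h : IsCC Q) (x y z : Q) : ∃ m ∈ nucleus Q,
    y * z = (z * y) * m ∧ (x * y) * z = ((x * z) * y) * m := by
  obtain ⟨m, hm, e⟩ := comm2 h y z
  refine ⟨m, hm, e, ?_⟩
  rw [h.2, e, ← hm.2.2 z y, ld_mul, hm.2.2]

theorem eqv_swap (h : IsCC Q) (x y z : Q) : Eqv (x * (y * z)) (y * (x * z)) := by
  obtain ⟨n, hn, _, e⟩ := swapL h x y z
  obtain ⟨m, hm, e'⟩ := mv_r h hn (y * (x * z))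
  exact ⟨m, hm, by rw [e, e']⟩

theorem eqv_assoc (h : IsCC Q) (x y z : Q) : Eqv ((x * y) * z) (x * (y * z)) :=
  Eqv.trans (comm2 h (x * y) z) (Eqv.trans (eqv_swap h z x y) (Eqv.mul_left x (comm2 h z y)))

/-- associator -/
def asc (x y z : Q) : Q := ld (x * (y * z)) ((x * y) * z)

theorem asc_spec (x y z : Q) : (x * y) * z = (x * (y * z)) * asc x y z := (mul_ld _ _).symm

theorem asc_nuc (h : IsCC Q) (x y z : Q) : asc x y z ∈ nucleus Q := by
  obtain ⟨n, hn, e⟩ := eqv_assoc h x y z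
  rw [asc, e, ld_mul]
  exact hn

def ph (x y z : Q) : Q := ld (x * y) (x * (y * z))

theorem ph_spec (x y z : Q) : (x * y) * ph x y z = x * (y * z) := mul_ld _ _

theorem ph_asc (h : IsCC Q) (x y z : Q) : z = ph x y z * asc x y z := by
  have hn := asc_nuc h x y z
  apply lcancel (a := x * y)
  rw [hn.2.2, ph_spec, asc_spec]

theorem ph_mul (h : IsCC Q) (x y z w : Q) : ph x y (z * w) = ph x y z * ph x y w := by
  have h1 : ∀ w, x * (y * (z * w)) = rd (x * rd (y * z) y) x * (x * (y * w)) := fun w => by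
    rw [h.1 y z w, h.1 x]
  have h2 : x * (y * z) = rd (x * rd (y * z) y) x * (x * y) := by
    have := h1 1
    rwa [mul_one, mul_one] at this
  apply lcancel (a := x * y)
  rw [ph_spec, h1, h.1 (x * y), ph_spec, ph_spec, h2, mul_rd]

theorem ph_nuc {n : Q} (hn : n ∈ nucleus Q) (x y : Q) : ph x y n = n := by
  rw [ph, hn.2.2, ld_mul]

def ZN (Q : Type*) [Loop Q] : Set Q := {a | a ∈ nucleus Q ∧ ∀ n ∈ nucleus Q, a * n = n * a}

theorem asc_Z (h : IsCC Q) (x y z : Q) : asc x y z ∈ ZN Q := by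
  refine ⟨asc_nuc h x y z, fun n hn => ?_⟩
  have ha := asc_nuc h x y z
  have e := ph_asc h x y z
  set a := asc x y z with ha'
  set p := ph x y z with hp
  -- p n = k p , and z n = k z
  obtain ⟨k, hk, e1⟩ := mv_l h hn z
  have e2 : p * n = k * p := by
    have := congrArg (ph x y) e1
    rwa [ph_mul h, ph_mul h, ph_nuc hn, ph_nuc hk] at this
  apply lcancel (a := p)
  rw [ha.2.1, ← e, e1, hn.2.1, e2, ← hk.1, ← e]

theorem asc_symL (h : IsCC Q) (x y z : Q) : asc x y z = asc y x z := by
  obtain ⟨n, hn, e, e'⟩ := swapL h x y z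
  apply lcancel (a := x * (y * z))
  rw [← asc_spec, e, e', ← hn.1, asc_spec, hn.1]

theorem asc_symR (h : IsCC Q) (x y z : Q) : asc x y z = asc x z y := by
  obtain ⟨n, hn, e, e'⟩ := swapR h x y z
  apply lcancel (a := x * (y * z))
  rw [← asc_spec, e, e', asc_spec x z y, ← hn.2.2 _ (asc x z y), (asc_Z h x z y).2 n hn, hn.2.1,
    hn.2.2 x]

structure ZT (Q : Type*) [Loop Q] where
  val : Q
  mem : val ∈ ZN Q

theorem ZT.ext' {a b : ZT Q} (h : a.val = b.val) : a = b := by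
  cases a; cases b; cases h; rfl

instance : Add (ZT Q) := ⟨fun a b => ⟨a.val * b.val, nuc_mul a.mem.1 b.mem.1, fun n hn => by
  rw [← a.mem.1.1, b.mem.2 n hn, a.mem.1.1, a.mem.2 n hn, a.mem.1.2.1]⟩⟩
instance : Zero (ZT Q) := ⟨⟨1, nuc_one, fun n _ => by rw [one_mul, mul_one]⟩⟩
instance : Neg (ZT Q) := ⟨fun a => ⟨ld a.val 1, nuc_inv a.mem.1, fun n hn => by
  apply lcancel (a := a.val)
  rw [a.mem.1.1, mul_ld, one_mul, a.mem.1.1, a.mem.2 n hn, ← a.mem.1.2.1, mul_ld, mul_one]⟩⟩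

theorem ZT.add_val (a b : ZT Q) : (a + b).val = a.val * b.val := rfl
theorem ZT.zero_val : (0 : ZT Q).val = 1 := rfl
theorem ZT.neg_val (a : ZT Q) : (-a).val = ld a.val 1 := rfl

instance : AddCommGroup (ZT Q) :=
  { AddGroup.ofLeftAxioms (G := ZT Q)
      (fun a b c => ZT.ext' (a.mem.1.1 b.val c.val).symm)
      (fun a => ZT.ext' (one_mul a.val))
      (fun a => ZT.ext' (nuc_inv_mul a.mem.1)) with
    add_comm := fun a b => ZT.ext' (a.mem.2 _ b.mem.1) }

theorem conj_spec (w a : Q) : w * ld w (a * w) = a * w := mul_ld _ _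

theorem conj_mem (h : IsCC Q) (w : Q) {a : Q} (ha : a ∈ ZN Q) : ld w (a * w) ∈ ZN Q := by
  have ht : ld w (a * w) ∈ nucleus Q := by
    obtain ⟨m, hm, e⟩ := mv_r h ha.1 w
    rw [e, ld_mul]; exact hm
  refine ⟨ht, fun n hn => ?_⟩
  obtain ⟨k, hk, e⟩ := mv_l h hn w
  apply lcancel (a := w)
  rw [ht.2.1, conj_spec, hn.2.1, e, ← ha.1.1, e, ha.1.1, ha.2 k hk, ← hk.1, ← hk.1, conj_spec]

def act (h : IsCC Q) (w : Q) : ZT Q →+ ZT Q :=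
  AddMonoidHom.mk' (fun a => ⟨ld w (a.val * w), conj_mem h w a.mem⟩) (fun a b => by
    apply ZT.ext'
    apply lcancel (a := w)
    have hb := (conj_mem h w b.mem).1
    simp only [ZT.add_val]
    rw [hb.2.2, conj_spec, conj_spec, ← a.mem.1.1, ← a.mem.1.1, conj_spec])

theorem act_spec (h : IsCC Q) (w : Q) (a : ZT Q) : w * (act h w a).val = a.val * w :=
  conj_spec _ _

theorem act_mul (h : IsCC Q) (v w : Q) (a : ZT Q) : act h (v * w) a = act h w (act h v a) := by
  apply ZT.ext'
  apply lcancel (a := v * w)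
  have h1 := (act h w (act h v a)).mem.1
  have h2 := (act h v a).mem.1
  rw [act_spec, ← h1.2.2, act_spec, h2.2.1, act_spec, a.mem.1.1]

theorem act_nuc (h : IsCC Q) {n : Q} (hn : n ∈ nucleus Q) (a : ZT Q) : act h n a = a := by
  apply ZT.ext'
  apply lcancel (a := n)
  rw [act_spec, a.mem.2 n hn]

theorem act_comm (h : IsCC Q) (v w : Q) (a : ZT Q) :
    act h v (act h w a) = act h w (act h v a) := by
  rw [← act_mul, ← act_mul]
  obtain ⟨m, hm, e⟩ := comm2 h w v
  rw [e, act_mul, act_nuc h hm]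

theorem act_inj (h : IsCC Q) {w : Q} {a : ZT Q} (e : act h w a = 0) : a = 0 := by
  have := act_spec h w a
  rw [e, ZT.zero_val, mul_one] at this
  apply ZT.ext'
  apply rcancel (a := w)
  rw [← this, ZT.zero_val, one_mul]

def F (h : IsCC Q) (x y z : Q) : ZT Q := ⟨asc x y z, asc_Z h x y z⟩

theorem F_L (h : IsCC Q) (x y z : Q) : F h x y z = F h y x z := ZT.ext' (asc_symL h x y z)
theorem F_R (h : IsCC Q) (x y z : Q) : F h x y z = F h x z y := ZT.ext' (asc_symR h x y z)

theorem F_eq_zero (h : IsCC Q) {x y z : Q} : F h x y z = 0 ↔ x * (y * z) = (x * y) * z := by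
  constructor
  · intro e
    have : asc x y z = 1 := congrArg ZT.val e
    rw [asc_spec, this, mul_one]
  · intro e
    apply ZT.ext'
    apply lcancel (a := x * (y * z))
    change _ * asc x y z = _ * 1
    rw [← asc_spec, mul_one, e]

theorem F_mul (h : IsCC Q) (x y z w : Q) :
    F h x y (z * w) = act h w (F h x y z) + F h x y w := by
  have hz : z = ph x y z * (F h x y z).val := ph_asc h x y z
  have hw : w = ph x y w * (F h x y w).val := ph_asc h x y w
  have hzw : z * w = ph x y (z * w) * (F h x y (z * w)).val := ph_asc h x y (z * w)
  have ea : act h w (F h x y z) = act h (ph x y w) (F h x y z) := by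
    conv_lhs => rw [hw]
    rw [act_mul, act_nuc h (F h x y w).mem.1]
  rw [ea]
  apply ZT.ext'
  apply lcancel (a := ph x y (z * w))
  rw [← hzw, ZT.add_val]
  have s := act_spec h (ph x y w) (F h x y z)
  set t := act h (ph x y w) (F h x y z) with ht
  rw [t.mem.1.2.1, ph_mul h, ← t.mem.1.2.2, s, (F h x y z).mem.1.2.1, ← hz,
    ← (F h x y w).mem.1.2.2, ← hw]

theorem F_one (h : IsCC Q) (x y : Q) : F h x y 1 = 0 := by
  rw [F_eq_zero, mul_one, mul_one]

theorem F_four (h : IsCC Q) (x y z w : Q) :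
    act h w (F h x y z) + F h x y w = act h z (F h x y w) + F h x y z := by
  rw [← F_mul, ← F_mul]
  obtain ⟨m, hm, e⟩ := comm2 h z w
  have : F h x y m = 0 := (F_eq_zero h).2 (hm.2.2 _ _)
  rw [e, F_mul h x y _ m, this, act_nuc h hm, add_zero]

theorem F_wip (h : IsCC Q) {c : Q} (hw : IsWIP c) (x : Q) :
    act h c (F h c x x) + F h c c x = 0 := by
  have h1 : F h x c (ld (x * c) 1) = 0 := by
    rw [F_eq_zero, hw, mul_ld, mul_ld]
  have h2 := F_mul h x c (x * c) (ld (x * c) 1)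
  rw [mul_ld, F_one, h1, add_zero] at h2
  have h3 := act_inj h h2.symm
  rw [F_mul, F_L h x c x, F_L h x c c, F_R h c x c] at h3
  exact h3

theorem F_wip2 (h : IsCC Q) {c : Q} (hw : IsWIP c) (x y : Q) :
    act h c (F h c x y) + F h c x y = 0 := by
  have ex := F_wip h hw x
  have ey := F_wip h hw y
  have exy := F_wip h hw (x * y)
  have e4 := F_four h c x c y
  rw [F_R h c x c] at e4
  have e1 : F h c (x * y) (x * y) = act h y (act h y (F h c x x))
      + act h y (F h c x y) + act h y (F h c x y) + F h c y y := by
    rw [F_mul, F_R h c (x * y) x, F_R h c (x * y) y, F_mul, F_mul, F_R h c y x, map_add]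
    abel
  rw [e1, F_mul] at exy
  simp only [map_add] at exy
  have ex' := congrArg (act h y) ex
  have ex2 := congrArg (act h y) ex'
  simp only [map_add, map_zero] at ex' ex2
  rw [act_comm h c y, act_comm h c y, act_comm h c y] at exy
  have e4' := congrArg (act h y) e4
  simp only [map_add] at e4'
  apply act_inj h (w := y)
  rw [map_add]
  generalize act h y (act h c (F h c x y)) = p1 at *
  generalize act h y (F h c x y) = p2 at *
  generalize act h y (act h y (F h c c x)) = p3 at *
  generalize act h y (F h c c x) = p4 at *
  generalize act h y (act h y (act h c (F h c x x))) = p5 at *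
  generalize act h c (F h c y y) = p6 at *
  have k : p1 + p2 = (p5 + p1 + p1 + p6 + (p4 + F h c c y)) - (p5 + p3) - (p6 + F h c c y)
      + ((p3 + p2) - (p1 + p4)) := by abel
  rw [k, exy, ex2, ey, e4']
  abel

theorem self_closure (a : Q) : a ∈ closure {a} :=
  Set.mem_sInter.2 fun _ hT => hT.2 rfl

theorem F_sub (h : IsCC Q) (x y : Q) : IsSubloop {z | F h x y z = 0} := by
  refine ⟨F_one h x y, fun a ha b hb => ?_, fun a ha b hb => ?_, fun a ha b hb => ?_⟩ <;>
    simp only [Set.mem_ofPred_eq] at *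
  · rw [F_mul, ha, hb, map_zero, add_zero]
  · have := F_mul h x y a (ld a b)
    rw [mul_ld, ha, hb, map_zero, zero_add] at this
    exact this.symm
  · have := F_mul h x y (rd a b) b
    rw [rd_mul, ha, hb, add_zero] at this
    exact act_inj h this.symm

theorem F_ext (h : IsCC Q) {S : Set Q} {x y : Q} (hS : ∀ z ∈ S, F h x y z = 0) :
    ∀ z ∈ closure S, F h x y z = 0 :=
  fun z hz => Set.mem_sInter.1 hz _ ⟨F_sub h x y, hS⟩

theorem F_gen (h : IsCC Q) {S : Set Q} (hS : ∀ x ∈ S, ∀ y ∈ S, ∀ z ∈ S, F h x y z = 0) :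
    ∀ x ∈ closure S, ∀ y ∈ closure S, ∀ z ∈ closure S, F h x y z = 0 := by
  have h1 : ∀ x ∈ S, ∀ y ∈ S, ∀ z ∈ closure S, F h x y z = 0 :=
    fun x hx y hy => F_ext h (hS x hx y hy)
  have h2 : ∀ x ∈ S, ∀ y ∈ closure S, ∀ z ∈ closure S, F h x y z = 0 :=
    fun x hx y hy => F_ext h fun z hz => by rw [F_R]; exact h1 x hx z hz y hy
  exact fun x hx y hy => F_ext h fun z hz => by
    rw [F_R, F_L]; exact h2 z hz x hx y hy

end aux

end Loop

open Loop

/-- In a CC-loop, if `c` is WIP and `b`, `c` are power-associative, then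
`⟨b², c⟩` is a group. -/
theorem stmt_16 {Q : Type*} [Loop Q] (hcc : IsCC Q) (b c : Q)
    (hwip : IsWIP c) (hb : IsPA b) (hc : IsPA c) :
    ∀ x ∈ closure {b * b, c}, ∀ y ∈ closure {b * b, c}, ∀ z ∈ closure {b * b, c},
      x * (y * z) = (x * y) * z := by
  have sb := self_closure b
  have sc := self_closure c
  have fb : F hcc b b b = 0 := (F_eq_zero hcc).2 (hb b sb b sb b sb)
  have fc : F hcc c c c = 0 := (F_eq_zero hcc).2 (hc c sc c sc c sc)
  have w1 := F_wip hcc hwip b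
  have w2 := F_wip2 hcc hwip b b
  have e1 : F hcc c c b = F hcc c b b := by
    rw [← w2] at w1
    exact add_left_cancel w1
  have ebb : F hcc b b c = F hcc c b b := by rw [F_R hcc b b c, F_L hcc b c b]
  have e2 := F_four hcc b b c b
  rw [fb, map_zero, add_zero, zero_add, ebb] at e2
  have e3 := F_four hcc c c b c
  rw [fc, map_zero, add_zero, zero_add, e1] at e3
  have e4 : F hcc c b b + F hcc c b b = 0 := by
    rw [e3] at w2
    exact w2
  have g1 : F hcc c c (b * b) = 0 := by rw [F_mul, e1, e2, e4]
  have g2 : F hcc c b (b * b) = 0 := by rw [F_mul, e2, e4]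
  have g3 : F hcc c (b * b) (b * b) = 0 := by
    rw [F_mul, F_R hcc c (b * b) b, g2, map_zero, add_zero]
  have g4 : F hcc b b (b * b) = 0 := by rw [F_mul, fb, map_zero, add_zero]
  have g5 : F hcc b (b * b) (b * b) = 0 := by
    rw [F_mul, F_R hcc b (b * b) b, g4, map_zero, add_zero]
  have g6 : F hcc (b * b) (b * b) (b * b) = 0 := by
    rw [F_mul, F_R hcc (b * b) (b * b) b, F_L hcc (b * b) b, g5, map_zero, add_zero]
  intro x hx y hy z hz
  rw [← F_eq_zero hcc]
  refine F_gen hcc ?_ x hx y hy z hz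
  rintro x (rfl | rfl) y (rfl | rfl) z (rfl | rfl)
  · exact g6
  · rw [F_R, F_L]; exact g3
  · rw [F_L]; exact g3
  · rw [F_L, F_R]; exact g1
  · exact g3
  · rw [F_R]; exact g1
  · exact g1
  · exact fc
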